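/- Let n ≥ 1, α₁,…,αₙ ∈ ℂ, d ≥ 0, and let t₁,…,tₙ > 0 be reals. For each k let (t_{k,l})_{l∈ℕ} be a sequence of positive reals with t_{k,l} → tₖ as l → ∞. Define b_l(z) = 1 + Σ_{k=1}^{n} αₖ·e^{−i·t_{k,l}·z} and b(z) = 1 + Σ_{k=1}^{n} αₖ·e^{−i·tₖ·z}. If for every l every zero z of b_l satisfies |Im z| > d, then every zero z of b satisfies |Im z| ≥ d; in particular b has no zeros in the open strip |Im z| < d. -/

import Mathlib

open Filter
open Metric Topology

/-- **Hurwitz's theorem**: a locally uniform limit of nowhere vanishing holomorphic functions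
does not vanish at any point near which it is not identically zero. -/
theorem TendstoLocallyUniformlyOn.ne_zero_of_frequently_ne_zero {ι : Type*} {p : Filter ι}
    [p.NeBot] {F : ι → ℂ → ℂ} {f : ℂ → ℂ} {U : Set ℂ} {z₀ : ℂ}
    (h : TendstoLocallyUniformlyOn F f p U) (hU : IsOpen U)
    (hF : ∀ᶠ i in p, DifferentiableOn ℂ (F i) U) (hF₀ : ∀ᶠ i in p, ∀ z ∈ U, F i z ≠ 0)
    (hz₀ : z₀ ∈ U) (hf : ∃ᶠ z in 𝓝 z₀, f z ≠ 0) : f z₀ ≠ 0 := by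
  intro hfz₀
  have hfd : DifferentiableOn ℂ f U := h.differentiableOn hF hU
  have hne : ∀ᶠ z in 𝓝[≠] z₀, f z ≠ 0 :=
    (hfd.analyticAt (hU.mem_nhds hz₀)).eventually_eq_zero_or_eventually_ne_zero.resolve_left
      fun h0 => hf (h0.mono fun z hz => not_not.2 hz)
  obtain ⟨r, hr, hrs⟩ := nhds_basis_closedBall.mem_iff.1
    ((eventually_nhdsWithin_iff.1 hne).and (hU.mem_nhds hz₀))
  have hrU : closedBall z₀ r ⊆ U := fun z hz => (hrs hz).2
  have hfS : ∀ z ∈ sphere z₀ r, f z ≠ 0 := fun z hz =>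
    (hrs (sphere_subset_closedBall hz)).1 (ne_of_mem_sphere hz hr.ne')
  obtain ⟨w, hw, hmin⟩ := (isCompact_sphere z₀ r).exists_isMinOn
    (NormedSpace.sphere_nonempty.2 hr.le)
    (hfd.continuousOn.mono (sphere_subset_closedBall.trans hrU)).norm
  have hε : 0 < ‖f w‖ := norm_pos_iff.2 (hfS w hw)
  have hunif : TendstoUniformlyOn F f p (closedBall z₀ r) :=
    (tendstoLocallyUniformlyOn_iff_forall_isCompact hU).1 h _ hrU (isCompact_closedBall z₀ r)
  obtain ⟨i, hi, hid, hi0⟩ :=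
    ((Metric.tendstoUniformlyOn_iff.1 hunif (‖f w‖ / 3) (by positivity)).and
      (hF.and hF₀)).exists
  have hmax : ‖(F i z₀)⁻¹‖ ≤ (2 * ‖f w‖ / 3)⁻¹ := by
    refine Complex.norm_le_of_forall_mem_frontier_norm_le (f := fun z => (F i z)⁻¹)
      (U := ball z₀ r) isBounded_ball
      (DifferentiableOn.diffContOnCl_ball (U := U) (hid.inv hi0) hrU) (fun z hz => ?_)
      (subset_closure (mem_ball_self hr))
    rw [frontier_ball z₀ hr.ne'] at hz
    have h1 : ‖f w‖ ≤ ‖f z‖ := hmin hz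
    have h2 := hi z (sphere_subset_closedBall hz)
    rw [dist_eq_norm] at h2
    have h3 := norm_sub_norm_le (f z) (F i z)
    rw [norm_inv]
    exact inv_anti₀ (by positivity) (by linarith)
  have hclose := hi z₀ (mem_closedBall_self hr.le)
  rw [hfz₀, dist_zero_left] at hclose
  rw [norm_inv, inv_le_inv₀ (norm_pos_iff.2 (hi0 z₀ hz₀)) (by positivity)] at hmax
  linarith

/-- If `F` is jointly continuous, then `F x` converges to `F x₀` locally uniformly as `x → x₀`. -/
theorem Continuous.tendstoLocallyUniformly_of_uncurry {X Y E : Type*} [TopologicalSpace X]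
    [TopologicalSpace Y] [LocallyCompactSpace Y] [UniformSpace E] {F : X → Y → E}
    (hF : Continuous F.uncurry) (x₀ : X) : TendstoLocallyUniformly F (F x₀) (𝓝 x₀) := by
  rw [tendstoLocallyUniformly_iff_forall_isCompact]
  intro K hK u hu
  obtain ⟨v, hv, hvu⟩ := hK.mem_uniformity_of_prod (s := Set.univ) hF.continuousOn
    (Set.mem_univ x₀) (symm_le_uniformity hu)
  rw [nhdsWithin_univ] at hv
  exact mem_of_superset hv hvu

/-- The exponential polynomial `z ↦ 1 + ∑ k, α k * exp (-(I * t k * z))`. -/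
noncomputable def expPolynomial {ι : Type*} [Fintype ι] (α : ι → ℂ) (t : ι → ℝ) (z : ℂ) : ℂ :=
  1 + ∑ k, α k * Complex.exp (-(Complex.I * (t k : ℂ) * z))

namespace expPolynomial

variable {ι : Type*} [Fintype ι] (α : ι → ℂ)

theorem continuous_uncurry : Continuous (expPolynomial α).uncurry := by
  unfold expPolynomial Function.uncurry
  fun_prop

theorem differentiable (t : ι → ℝ) : Differentiable ℂ (expPolynomial α t) := by
  unfold expPolynomial
  fun_prop

theorem tendsto_neg_mul_I {t : ι → ℝ} (ht : ∀ k, 0 < t k) :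
    Tendsto (fun y : ℝ => expPolynomial α t (-(y * Complex.I))) atTop (𝓝 1) := by
  have hexp : ∀ k, Tendsto
      (fun y : ℝ => Complex.exp (-(Complex.I * (t k : ℂ) * -(y * Complex.I)))) atTop (𝓝 0) := by
    intro k
    rw [Complex.tendsto_exp_nhds_zero_iff]
    simpa [mul_assoc] using tendsto_id.const_mul_atTop (ht k)
  simpa [expPolynomial] using
    (tendsto_finsetSum Finset.univ fun k _ => (hexp k).const_mul (α k)).const_add 1

theorem frequently_ne_zero {t : ι → ℝ} (ht : ∀ k, 0 < t k) (z₀ : ℂ) :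
    ∃ᶠ z in 𝓝 z₀, expPolynomial α t z ≠ 0 := by
  intro h
  have h0 : expPolynomial α t = 0 :=
    AnalyticOnNhd.eq_of_eventuallyEq (z₀ := z₀)
      (fun z _ => (differentiable α t).analyticAt z) analyticOnNhd_const
      (h.mono fun z hz => not_not.1 hz)
  have h1 := tendsto_neg_mul_I α ht
  simp [h0, tendsto_const_nhds_iff] at h1

end expPolynomial

/-- **Hurwitz-theorem passage from rational to irrational time points
(Corollary 4.1).**  If `t_{k,l} → tₖ` and for every `l` all zeros of
`b_l(z) = 1 + ∑ k, αₖ e^{−i t_{k,l} z}` satisfy `|Im z| > d`, then every zero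
of `b(z) = 1 + ∑ k, αₖ e^{−i tₖ z}` satisfies `|Im z| ≥ d`; in particular `b`
has no zeros in the open strip `|Im z| < d`. -/
theorem hurwitz_limit_zeros_avoid_strip
    (n : ℕ) (hn : 1 ≤ n) (α : Fin n → ℂ) (d : ℝ) (hd : 0 ≤ d)
    (t : Fin n → ℝ) (ht : ∀ k, 0 < t k)
    (t' : Fin n → ℕ → ℝ) (ht' : ∀ k l, 0 < t' k l)
    (htend : ∀ k, Tendsto (t' k) atTop (nhds (t k)))
    (hzeros : ∀ l : ℕ, ∀ z : ℂ,
      1 + ∑ k, α k * Complex.exp (-(Complex.I * (t' k l : ℂ) * z)) = 0 →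
        d < |z.im|) :
    (∀ z : ℂ,
      1 + ∑ k, α k * Complex.exp (-(Complex.I * (t k : ℂ) * z)) = 0 →
        d ≤ |z.im|) ∧
    (∀ z : ℂ, |z.im| < d →
      1 + ∑ k, α k * Complex.exp (-(Complex.I * (t k : ℂ) * z)) ≠ 0) := by
  have hstrip : ∀ z : ℂ, |z.im| < d → expPolynomial α t z ≠ 0 := by
    intro z hz
    have hU : IsOpen {z : ℂ | |z.im| < d} :=
      isOpen_lt Complex.continuous_im.abs continuous_const
    have hlim : TendstoLocallyUniformlyOn (fun l => expPolynomial α fun k => t' k l)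
        (expPolynomial α t) atTop {z : ℂ | |z.im| < d} := fun u hu x _ => by
      obtain ⟨s, hs, h⟩ :=
        (expPolynomial.continuous_uncurry α).tendstoLocallyUniformly_of_uncurry t u hu x
      exact ⟨s, mem_nhdsWithin_of_mem_nhds hs, (tendsto_pi_nhds.2 htend).eventually h⟩
    exact hlim.ne_zero_of_frequently_ne_zero hU
      (.of_forall fun l => (expPolynomial.differentiable α _).differentiableOn)
      (.of_forall fun l z hz h0 => (hzeros l z h0).not_gt hz) hz
      (expPolynomial.frequently_ne_zero α ht z)
  exact ⟨fun z hz => not_lt.1 fun h => hstrip z h hz, hstrip⟩
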